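/- arXiv:1608.00567 — 5 statements merged into one kernel-verified Lean document; each statement's English description precedes it below -/
import Mathlib

section
/- If a DNA sequence of length n > 0 consists of tandem perfect repeats of size p (with p ∣ n and p ≥ 1), then its normalized distribution uniformity satisfies NDU(p) = 3n/(4p) = (3/4)·CP(p), where CP(p) = n/p is the copy number. -/
/-- Congruence derivative (CD) matrix entry: number of positions `k < n`
with `s k = i` and `k ≡ j (mod p)`. -/
def cdMatrix {n : ℕ} (p : ℕ) (s : Fin n → Fin 4) (i : Fin 4) (j : Fin p) : ℕ :=
  (Finset.univ.filter (fun k : Fin n => s k = i ∧ (k : ℕ) % p = (j : ℕ))).card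

/-- Distribution uniformity of periodicity `p`, computed in ℚ. -/
def DU {n : ℕ} (p : ℕ) (s : Fin n → Fin 4) : ℚ :=
  ∑ i : Fin 4, ∑ j : Fin p, ((cdMatrix p s i j : ℚ) - (n : ℚ) / (4 * p)) ^ 2

theorem cd_card {p c : ℕ} (hp : 1 ≤ p) (j : Fin p) :
    (Finset.univ.filter (fun k : Fin (p * c) => (k : ℕ) % p = (j : ℕ))).card = c := by
  have hj := j.2
  have key : ∀ a : Fin c, (j : ℕ) + p * (a : ℕ) < p * c := by
    intro a
    have : p * ((a : ℕ) + 1) ≤ p * c := Nat.mul_le_mul_left p a.2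
    rw [Nat.mul_add] at this
    omega
  have h : (Finset.univ.filter (fun k : Fin (p * c) => (k : ℕ) % p = (j : ℕ)))
      = Finset.univ.image (fun a : Fin c => (⟨(j : ℕ) + p * (a : ℕ), key a⟩ : Fin (p * c))) := by
    ext k
    simp only [Finset.mem_filter, Finset.mem_univ, true_and, Finset.mem_image]
    constructor
    · intro hk
      refine ⟨⟨(k : ℕ) / p, Nat.div_lt_of_lt_mul k.2⟩, ?_⟩
      apply Fin.ext
      simp only
      rw [← hk]
      exact Nat.mod_add_div _ _
    · rintro ⟨a, rfl⟩
      simp [Nat.add_mul_mod_self_left, Nat.mod_eq_of_lt hj]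
  rw [h, Finset.card_image_of_injective, Finset.card_univ, Fintype.card_fin]
  intro a b hab
  simp only [Fin.mk.injEq] at hab
  apply Fin.ext
  exact Nat.eq_of_mul_eq_mul_left hp (by omega)

/-- for tandem perfect repeats, NDU(p) = 3n/(4p) = (3/4)·CP(p), CP(p) = n/p. -/
theorem ndu_perfect_repeats {n p : ℕ} (hn : 0 < n) (hp : 1 ≤ p) (hd : p ∣ n)
    (s : Fin n → Fin 4)
    (hper : ∀ k k' : Fin n, (k : ℕ) % p = (k' : ℕ) % p → s k = s k') :
    DU p s / n = 3 * (n : ℚ) / (4 * p) ∧ DU p s / n = (3 / 4) * ((n : ℚ) / p) := by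
  obtain ⟨c, rfl⟩ := hd
  have hc : 0 < c := Nat.pos_of_mul_pos_left hn
  have hle : p ≤ p * c := Nat.le_mul_of_pos_right p hc
  have hcd : ∀ i (j : Fin p), cdMatrix p s i j
      = if s ⟨j, lt_of_lt_of_le j.2 hle⟩ = i then c else 0 := by
    intro i j
    unfold cdMatrix
    have hs : ∀ k : Fin (p * c), (k : ℕ) % p = j → s k = s ⟨j, lt_of_lt_of_le j.2 hle⟩ := by
      intro k hk
      apply hper
      simp [hk, Nat.mod_eq_of_lt j.2]
    split_ifs with h
    · refine Eq.trans ?_ (cd_card (c := c) hp j)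
      congr 1
      ext k
      simp only [Finset.mem_filter, Finset.mem_univ, true_and]
      exact ⟨fun h' => h'.2, fun h' => ⟨(hs k h').trans h, h'⟩⟩
    · rw [Finset.card_eq_zero, Finset.filter_eq_empty_iff]
      rintro k - ⟨h1, h2⟩
      exact h ((hs k h2).symm.trans h1)
  have hp' : (p : ℚ) ≠ 0 := by positivity
  have hc' : (c : ℚ) ≠ 0 := by positivity
  have hDU : DU p s = p * (3 / 4 * (c : ℚ) ^ 2) := by
    unfold DU
    rw [Finset.sum_comm]
    have : ∀ j : Fin p, ∑ i : Fin 4, ((cdMatrix p s i j : ℚ) - ((p * c : ℕ) : ℚ) / (4 * p)) ^ 2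
        = 3 / 4 * (c : ℚ) ^ 2 := by
      intro j
      have hq : ((p * c : ℕ) : ℚ) / (4 * p) = c / 4 := by
        push_cast
        field_simp
      simp only [hcd, hq]
      generalize s ⟨j, lt_of_lt_of_le j.2 hle⟩ = t
      fin_cases t <;> simp [Fin.sum_univ_four] <;> ring
    rw [Finset.sum_congr rfl (fun j _ => this j)]
    simp
  rw [hDU]
  push_cast
  constructor <;> field_simp
end

section
/- For any DNA sequence of length n and any periodicity p ≥ 1 with p ∣ n, the distribution uniformity lies in the range [0, 3n²/(4p)]: that is, 0 ≤ DU(p) ≤ 3n²/(4p). -/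
theorem col_le {m p : ℕ} (hp : 1 ≤ p) (s : Fin (p * m) → Fin 4) (j : Fin p) :
    ∑ i : Fin 4, cdMatrix p s i j ≤ m := by
  have h1 : ∑ i : Fin 4, cdMatrix p s i j =
      (Finset.univ.filter (fun k : Fin (p * m) => (k : ℕ) % p = (j : ℕ))).card := by
    rw [Finset.card_eq_sum_card_fiberwise (f := s) (t := Finset.univ) (by simp)]
    refine Finset.sum_congr rfl fun i _ => ?_
    unfold cdMatrix
    congr 1
    ext k
    simp [and_comm]
  rw [h1]
  calc _ ≤ (Finset.range m).card := by
        refine Finset.card_le_card_of_injOn (fun k => (k : ℕ) / p) ?_ ?_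
        · intro k _
          simpa using Nat.div_lt_of_lt_mul k.2
        · intro a ha b hb hab
          simp only [Finset.coe_filter, Finset.mem_univ, true_and, Set.mem_setOf_eq] at ha hb hab
          apply Fin.ext
          rw [← Nat.div_add_mod (a : ℕ) p, ← Nat.div_add_mod (b : ℕ) p, hab, ha, hb]
    _ = m := by simp

theorem four_bound (a b c d m : ℚ) (ha : 0 ≤ a) (hb : 0 ≤ b) (hc : 0 ≤ c) (hd : 0 ≤ d)
    (h : a + b + c + d ≤ m) :
    (a - m / 4) ^ 2 + (b - m / 4) ^ 2 + (c - m / 4) ^ 2 + (d - m / 4) ^ 2 ≤ 3 * m ^ 2 / 4 := by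
  have h0 : 0 ≤ a + b + c + d := by positivity
  have h1 : 0 ≤ (a + b + c + d) * (m - (a + b + c + d)) := mul_nonneg h0 (by linarith)
  have h2 : 0 ≤ m * (m - (a + b + c + d)) := mul_nonneg (by linarith) (by linarith)
  have e : 0 ≤ a * b + a * c + a * d + b * c + b * d + c * d := by positivity
  nlinarith

/-- when p ∣ n, 0 ≤ DU(p) ≤ 3n²/(4p). -/
theorem du_range {n p : ℕ} (hp : 1 ≤ p) (hd : p ∣ n) (s : Fin n → Fin 4) :
    0 ≤ DU p s ∧ DU p s ≤ 3 * (n : ℚ) ^ 2 / (4 * p) := by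
  refine ⟨?_, ?_⟩
  · unfold DU
    positivity
  · obtain ⟨m, rfl⟩ := hd
    have hp0 : (p : ℚ) ≠ 0 := by positivity
    unfold DU
    rw [Finset.sum_comm]
    have e1 : ((p * m : ℕ) : ℚ) / (4 * p) = m / 4 := by
      push_cast
      field_simp
    have e2 : 3 * ((p * m : ℕ) : ℚ) ^ 2 / (4 * p) = ∑ _j : Fin p, 3 * (m : ℚ) ^ 2 / 4 := by
      simp
      field_simp
    rw [e1, e2]
    refine Finset.sum_le_sum fun j _ => ?_
    have h := col_le hp s j
    rw [Fin.sum_univ_four] at h ⊢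
    exact four_bound _ _ _ _ _ (by positivity) (by positivity) (by positivity) (by positivity)
      (by exact_mod_cast h)
end

section
/- If a DNA sequence of length n > 0 consists of tandem perfect repeats of size p (with p ∣ n and p ≥ 1) and its normalized distribution uniformity satisfies NDU(p) > 1, then the copy number satisfies CP(p) = n/p > 4/3 (equivalently, the sequence contains at least two full repeat copies, n/p ≥ 2). -/
/-- for tandem perfect repeats, NDU(p) > 1 implies copy number
CP(p) = n/p > 4/3, equivalently at least two full copies: n/p ≥ 2. -/
theorem ndu_gt_one_copies {n p : ℕ} (hn : 0 < n) (hp : 1 ≤ p) (hd : p ∣ n)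
    (s : Fin n → Fin 4)
    (hper : ∀ k k' : Fin n, (k : ℕ) % p = (k' : ℕ) % p → s k = s k')
    (h : 1 < DU p s / n) :
    (4 : ℚ) / 3 < (n : ℚ) / p ∧ 2 ≤ n / p := by
  have hp0 : (0 : ℚ) < p := by exact_mod_cast hp
  obtain ⟨m, rfl⟩ := hd
  have key : m ≠ 1 := by
    rintro rfl
    have hc : ∀ (i : Fin 4) (j : Fin p),
        cdMatrix p s i j = if s (Fin.cast (mul_one p).symm j) = i then 1 else 0 := by
      intro i j
      unfold cdMatrix
      have hk : ∀ k : Fin (p * 1), (k : ℕ) % p = (j : ℕ) ↔ k = Fin.cast (mul_one p).symm j := by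
        intro k
        have : (k : ℕ) < p := by have := k.2; omega
        rw [Nat.mod_eq_of_lt this, Fin.ext_iff]
        simp
      simp only [hk]
      split_ifs with hs
      · rw [Finset.card_eq_one]
        refine ⟨Fin.cast (mul_one p).symm j, ?_⟩
        ext k
        simp only [Finset.mem_filter, Finset.mem_univ, true_and, Finset.mem_singleton]
        constructor
        · exact fun h => h.2
        · rintro rfl
          exact ⟨hs, rfl⟩
      · rw [Finset.card_eq_zero, Finset.filter_eq_empty_iff]
        rintro k - ⟨h1, rfl⟩
        exact hs h1
    have hDU : DU p s = 3 / 4 * p := by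
      unfold DU
      rw [Finset.sum_comm]
      have hj : ∀ j : Fin p, ∑ i : Fin 4,
          ((cdMatrix p s i j : ℚ) - ((p * 1 : ℕ) : ℚ) / (4 * p)) ^ 2 = 3 / 4 := by
        intro j
        have hq : ((p * 1 : ℕ) : ℚ) / (4 * p) = 1 / 4 := by
          push_cast
          field_simp
        simp only [hc, hq]
        generalize s (Fin.cast (mul_one p).symm j) = a
        fin_cases a <;> simp [Fin.sum_univ_four] <;> norm_num
      rw [Finset.sum_congr rfl (fun j _ => hj j)]
      simp
      ring
    rw [hDU, lt_div_iff₀ (by exact_mod_cast hn)] at h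
    push_cast at h
    linarith
  have hm0 : m ≠ 0 := by
    rintro rfl
    simp at hn
  have hm : 2 ≤ m := by omega
  have hmq : (2 : ℚ) ≤ m := by exact_mod_cast hm
  constructor
  · push_cast
    rw [mul_div_cancel_left₀ _ hp0.ne']
    linarith
  · rw [Nat.mul_div_cancel_left _ hp]
    exact hm
end

section
/- If a DNA sequence of length n consists of tandem perfect repeats of size p, then for every positive multiple q·p of p with q·p ∣ n, the sequence also exhibits the harmonic periodicity q·p: the sequence is q·p-periodic and its distribution uniformity satisfies DU(q·p) = 3n²/(4qp). -/
theorem card_res (m r : ℕ) (j : Fin r) :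
    (Finset.univ.filter (fun k : Fin (r * m) => (k : ℕ) % r = (j : ℕ))).card = m := by
  have hj := j.isLt
  have hlt : ∀ t : Fin m, (j : ℕ) + r * t < r * m := by
    intro t
    have h1 : r * ((t : ℕ) + 1) ≤ r * m := Nat.mul_le_mul_left r t.isLt
    rw [Nat.mul_add] at h1
    omega
  have h : (Finset.univ.filter (fun k : Fin (r * m) => (k : ℕ) % r = (j : ℕ)))
      = (Finset.univ : Finset (Fin m)).image (fun t : Fin m => (⟨j + r * t, hlt t⟩ : Fin (r * m))) := by
    ext k
    simp only [Finset.mem_filter, Finset.mem_univ, true_and, Finset.mem_image]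
    constructor
    · intro hk
      refine ⟨⟨k / r, Nat.div_lt_of_lt_mul k.isLt⟩, ?_⟩
      apply Fin.ext
      simp only
      rw [← hk]
      exact Nat.mod_add_div _ _
    · rintro ⟨t, rfl⟩
      simp [Nat.mod_eq_of_lt hj]
  rw [h, Finset.card_image_of_injective]
  · simp
  · intro a b hab
    have h2 : (j : ℕ) + r * a = j + r * b := congrArg Fin.val hab
    have h3 : r * (a : ℕ) = r * b := by omega
    exact Fin.ext (Nat.eq_of_mul_eq_mul_left (by omega) h3)

theorem du_aux {m r : ℕ} (hr : 0 < r) (s : Fin (r * m) → Fin 4)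
    (hper : ∀ k k' : Fin (r * m), (k : ℕ) % r = (k' : ℕ) % r → s k = s k') :
    DU r s = 3 * ((r * m : ℕ) : ℚ) ^ 2 / (4 * r) := by
  have hr' : (r : ℚ) ≠ 0 := by positivity
  rcases Nat.eq_zero_or_pos m with rfl | hm
  · have : ∀ i j, cdMatrix r s i j = 0 := by
      intro i j
      unfold cdMatrix
      rw [Finset.card_eq_zero, Finset.filter_eq_empty_iff]
      intro k
      exact absurd k.isLt (by simp)
    simp [DU, this]
  · have hle : r ≤ r * m := Nat.le_mul_of_pos_right r hm
    have hcd : ∀ i j, cdMatrix r s i j = if s (Fin.castLE hle j) = i then m else 0 := by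
      intro i j
      have key : ∀ k : Fin (r * m), (k : ℕ) % r = j → s k = s (Fin.castLE hle j) := by
        intro k hk
        apply hper
        simp [hk, Nat.mod_eq_of_lt j.isLt]
      unfold cdMatrix
      split_ifs with h
      · refine Eq.trans ?_ (card_res m r j)
        congr 1
        ext k
        simp only [Finset.mem_filter, Finset.mem_univ, true_and]
        exact ⟨fun a => a.2, fun a => ⟨(key k a).trans h, a⟩⟩
      · rw [Finset.card_eq_zero, Finset.filter_eq_empty_iff]
        rintro k - ⟨h1, h2⟩
        exact h ((key k h2).symm.trans h1)
    unfold DU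
    rw [Finset.sum_comm]
    have hc : ((r * m : ℕ) : ℚ) / (4 * r) = m / 4 := by
      push_cast
      field_simp
    have : ∀ j : Fin r, ∑ i : Fin 4, ((cdMatrix r s i j : ℚ) - ((r * m : ℕ) : ℚ) / (4 * r)) ^ 2
        = 3 * (m : ℚ) ^ 2 / 4 := by
      intro j
      simp only [hcd, hc]
      generalize s (Fin.castLE hle j) = a
      fin_cases a <;> simp [Fin.sum_univ_four] <;> ring
    rw [Finset.sum_congr rfl (fun j _ => this j)]
    simp only [Finset.sum_const, Finset.card_univ, Fintype.card_fin, nsmul_eq_mul]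
    push_cast
    field_simp

/-- tandem perfect repeats of size p exhibit every harmonic
periodicity q·p (q > 0, q·p ∣ n): the sequence is q·p-periodic and
DU(q·p) = 3n²/(4qp). -/
theorem du_harmonic {n p : ℕ} (hp : 1 ≤ p) (s : Fin n → Fin 4)
    (hper : ∀ k k' : Fin n, (k : ℕ) % p = (k' : ℕ) % p → s k = s k') :
    ∀ q : ℕ, 0 < q → q * p ∣ n →
      ((∀ k k' : Fin n, (k : ℕ) % (q * p) = (k' : ℕ) % (q * p) → s k = s k') ∧
        DU (q * p) s = 3 * (n : ℚ) ^ 2 / (4 * (q * p))) := by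
  intro q hq hdvd
  have hper' : ∀ k k' : Fin n, (k : ℕ) % (q * p) = (k' : ℕ) % (q * p) → s k = s k' := by
    intro k k' h
    apply hper
    have h1 : (k : ℕ) ≡ k' [MOD q * p] := h
    exact h1.of_mul_left q
  refine ⟨hper', ?_⟩
  obtain ⟨m, rfl⟩ := hdvd
  have h := du_aux (Nat.mul_pos hq hp) s hper'
  rw [h]
  push_cast
  rfl
end

section
/- For any DNA sequence of length n > 0 and any periodicity p ≥ 1 with p ∣ n, the perfect level satisfies PR(p) = 1 if and only if the sequence consists of tandem perfect repeats of size p. -/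
/-- Dominant nucleotide frequency of column j. -/
def domFreq {n : ℕ} (p : ℕ) (s : Fin n → Fin 4) (j : Fin p) : ℕ :=
  Finset.univ.sup (fun i : Fin 4 => cdMatrix p s i j)

/-- Perfect level PR(p) = (Σⱼ d(j))/n, computed in ℚ. -/
def PR {n : ℕ} (p : ℕ) (s : Fin n → Fin 4) : ℚ :=
  (∑ j : Fin p, (domFreq p s j : ℚ)) / n

theorem sum_col_card {n p : ℕ} (hp : 1 ≤ p) :
    ∑ j : Fin p, (Finset.univ.filter (fun k : Fin n => (k : ℕ) % p = (j : ℕ))).card = n := by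
  have h := Finset.card_eq_sum_card_fiberwise (s := (Finset.univ : Finset (Fin n)))
    (t := (Finset.univ : Finset (Fin p)))
    (f := fun k : Fin n => (⟨(k : ℕ) % p, Nat.mod_lt _ hp⟩ : Fin p)) (by intro x _; simp)
  simp only [Fin.ext_iff, Finset.card_univ, Fintype.card_fin] at h
  exact h.symm

theorem cd_le {n p : ℕ} (s : Fin n → Fin 4) (i : Fin 4) (j : Fin p) :
    cdMatrix p s i j ≤ (Finset.univ.filter (fun k : Fin n => (k : ℕ) % p = (j : ℕ))).card := by
  apply Finset.card_le_card
  intro k hk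
  simp only [Finset.mem_filter] at hk ⊢
  exact ⟨hk.1, hk.2.2⟩

theorem dom_le {n p : ℕ} (s : Fin n → Fin 4) (j : Fin p) :
    domFreq p s j ≤ (Finset.univ.filter (fun k : Fin n => (k : ℕ) % p = (j : ℕ))).card :=
  Finset.sup_le fun i _ => cd_le s i j

theorem dom_eq_iff {n p : ℕ} (s : Fin n → Fin 4) (j : Fin p) :
    domFreq p s j = (Finset.univ.filter (fun k : Fin n => (k : ℕ) % p = (j : ℕ))).card ↔
      ∀ k k' : Fin n, (k : ℕ) % p = j → (k' : ℕ) % p = j → s k = s k' := by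
  constructor
  · intro h k k' hk hk'
    obtain ⟨i, -, hi⟩ := Finset.exists_mem_eq_sup (Finset.univ : Finset (Fin 4))
      Finset.univ_nonempty (fun i : Fin 4 => cdMatrix p s i j)
    have h2 : cdMatrix p s i j =
        (Finset.univ.filter (fun k : Fin n => (k : ℕ) % p = (j : ℕ))).card := by
      rw [← h]; exact hi.symm
    have h3 : (Finset.univ.filter (fun k : Fin n => s k = i ∧ (k : ℕ) % p = (j : ℕ))) =
        (Finset.univ.filter (fun k : Fin n => (k : ℕ) % p = (j : ℕ))) := by
      apply Finset.eq_of_subset_of_card_le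
      · intro k hk
        simp only [Finset.mem_filter] at hk ⊢
        exact ⟨hk.1, hk.2.2⟩
      · exact h2.ge
    have key : ∀ k : Fin n, (k : ℕ) % p = j → s k = i := by
      intro k hk
      have : k ∈ (Finset.univ.filter (fun k : Fin n => s k = i ∧ (k : ℕ) % p = (j : ℕ))) := by
        rw [h3]; simp [hk]
      exact (Finset.mem_filter.mp this).2.1
    rw [key k hk, key k' hk']
  · intro h
    apply le_antisymm (dom_le s j)
    by_cases he : ∃ k : Fin n, (k : ℕ) % p = j
    · obtain ⟨k, hk⟩ := he
      refine le_trans ?_ (Finset.le_sup (f := fun i : Fin 4 => cdMatrix p s i j)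
        (Finset.mem_univ (s k)))
      apply Finset.card_le_card
      intro k' hk'
      simp only [Finset.mem_filter] at hk' ⊢
      exact ⟨hk'.1, h _ _ hk'.2 hk, hk'.2⟩
    · rw [Finset.filter_false_of_mem (fun k _ hk => he ⟨k, hk⟩)]
      simp

/-- when p ∣ n, PR(p) = 1 iff the sequence consists of tandem
perfect repeats of size p. -/
theorem pr_eq_one_iff_perfect {n p : ℕ} (hn : 0 < n) (hp : 1 ≤ p) (hd : p ∣ n)
    (s : Fin n → Fin 4) :
    PR p s = 1 ↔ ∀ k k' : Fin n, (k : ℕ) % p = (k' : ℕ) % p → s k = s k' := by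
  have hn' : (n : ℚ) ≠ 0 := by exact_mod_cast hn.ne'
  unfold PR
  rw [div_eq_one_iff_eq hn', ← Nat.cast_sum, Nat.cast_inj]
  have h1 := Finset.sum_eq_sum_iff_of_le (s := (Finset.univ : Finset (Fin p)))
    (fun j _ => dom_le s j)
  rw [sum_col_card hp] at h1
  rw [h1]
  simp only [dom_eq_iff, Finset.mem_univ, true_implies]
  constructor
  · intro h k k' hk
    exact h ⟨(k : ℕ) % p, Nat.mod_lt _ hp⟩ k k' rfl hk.symm
  · intro h j k k' hk hk'
    exact h k k' (hk.trans hk'.symm)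
end
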